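/- For every integer n ≥ 4 there exist real numbers α_0, …, α_{n−2}, β_0, …, β_{n−2}, γ_0, γ_1, γ_2 such that the function F(h) = Σ_{k=0}^{n−2} α_k h^{k+1} + √(h(4+h)) Σ_{k=0}^{n−2} β_k h^k + (γ_0 + γ_1 h + γ_2 h²) · ln((2 + h + √(h(4+h)))/2) has at least 2n distinct simple zeros in (0,∞). In particular the 2n+1 functions h^{k+1} (0 ≤ k ≤ n−2), h^k √(h(4+h)) (0 ≤ k ≤ n−2) and h^k ln((2 + h + √(h(4+h)))/2) (k = 0,1,2) are linearly independent on (0,∞). -/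

import Mathlib

open Real

/-- The function `F` of Statement 12, depending on the coefficients
`α_0,…,α_{n−2}, β_0,…,β_{n−2}, γ_0, γ_1, γ_2`. -/
noncomputable def F12 (n : ℕ) (α β : ℕ → ℝ) (γ0 γ1 γ2 : ℝ) (h : ℝ) : ℝ :=
  (∑ k ∈ Finset.range (n - 1), α k * h ^ (k + 1))
    + Real.sqrt (h * (4 + h)) * (∑ k ∈ Finset.range (n - 1), β k * h ^ k)
    + (γ0 + γ1 * h + γ2 * h ^ 2) * Real.log ((2 + h + Real.sqrt (h * (4 + h))) / 2)

/-- Linearly independent functions `f i` on `s` can be interpolated at suitable points, as many as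
there are functions. -/
lemma exists_interpolation_points {ι : Type*} [Fintype ι] (s : Set ℝ) (f : ι → ℝ → ℝ)
    (hli : ∀ c : ι → ℝ, (∀ x ∈ s, ∑ i, c i * f i x = 0) → c = 0) :
    ∃ X : Finset ℝ, X.card = Fintype.card ι ∧ ↑X ⊆ s ∧
      ∀ y : ℝ → ℝ, ∃ c : ι → ℝ, ∀ x ∈ X, ∑ i, c i * f i x = y x := by
  classical
  have hli' : LinearIndependent ℝ (fun (i : ι) (x : s) => f i x) := by
    rw [Fintype.linearIndependent_iff]
    intro g hg
    refine congrFun (hli g fun x hx => ?_)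
    simpa using congrFun hg ⟨x, hx⟩
  obtain ⟨κ, a, ha, hspan, hind⟩ :=
    exists_linearIndependent' (K := ℝ) (fun (x : s) (i : ι) => f i x)
  have htop : Submodule.span ℝ (Set.range (fun (x : s) (i : ι) => f i x)) = ⊤ :=
    span_flip_eq_top_iff_linearIndependent.mpr hli'
  let b := Module.Basis.mk hind (hspan.trans htop).ge
  have : Fintype κ := FiniteDimensional.fintypeBasisIndex b
  have hcard : Fintype.card κ = Fintype.card ι := by
    rw [← Module.finrank_eq_card_basis b, Module.finrank_fintype_fun_eq_card]
  have hinj : Function.Injective fun k => (a k : ℝ) := Subtype.val_injective.comp ha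
  refine ⟨Finset.univ.map ⟨_, hinj⟩, by simpa using hcard, ?_, fun y => ?_⟩
  · intro x hx
    simp only [Finset.coe_map, Function.Embedding.coeFn_mk, Finset.coe_univ, Set.image_univ,
      Set.mem_range] at hx
    obtain ⟨k, rfl⟩ := hx
    exact (a k).2
  · let φ : (ι → ℝ) →ₗ[ℝ] ℝ := b.constr ℝ fun k => y (a k)
    refine ⟨fun i => φ (Pi.single i 1), fun x hx => ?_⟩
    simp only [Finset.mem_map, Finset.mem_univ, true_and, Function.Embedding.coeFn_mk] at hx
    obtain ⟨k, rfl⟩ := hx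
    have hk : φ (b k) = y (a k) := b.constr_basis ℝ _ k
    rw [← hk, φ.pi_apply_eq_sum_univ]
    refine Finset.sum_congr rfl fun i _ => ?_
    have hi : (fun j => if i = j then 1 else 0) = (Pi.single i 1 : ι → ℝ) := by
      funext j
      simp [Pi.single_apply, eq_comm]
    simp [b, mul_comm, hi]

/-- One-dimensional Sard lemma: a nontrivial interval contains a regular value. -/
lemma exists_regular_value {s : Set ℝ} {g : ℝ → ℝ} (hg : ∀ x ∈ s, DifferentiableAt ℝ g x)
    {a b : ℝ} (hab : a < b) : ∃ c ∈ Set.Ioo a b, ∀ x ∈ s, g x = c → deriv g x ≠ 0 := by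
  have hnull : MeasureTheory.volume (g '' {x ∈ s | deriv g x = 0}) = 0 := by
    refine MeasureTheory.addHaar_image_eq_zero_of_det_fderivWithin_eq_zero _
      (f' := fun _ => 0) (fun x hx => ?_) (fun x _ => ?_)
    · have h := (hg x hx.1).hasDerivAt.hasFDerivAt
      rw [hx.2] at h
      simpa using h.hasFDerivWithinAt
    · simp
  by_contra! hc
  have hsub : Set.Ioo a b ⊆ g '' {x ∈ s | deriv g x = 0} := fun c hcab => by
    obtain ⟨x, hxs, hxc, hx0⟩ := hc c hcab
    exact ⟨x, ⟨hxs, hx0⟩, hxc⟩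
  have h0 := MeasureTheory.measure_mono_null hsub hnull
  rw [Real.volume_Ioo, ENNReal.ofReal_eq_zero] at h0
  linarith

/-- A function taking the values `1` and `-1` alternately at `N + 1` points attains every
`c ∈ (-1, 1)` at least `N` times. -/
lemma exists_finset_of_alternating {s : Set ℝ} (hs : s.OrdConnected) {g : ℝ → ℝ}
    (hg : ContinuousOn g s) {N : ℕ} {x : Fin (N + 1) → ℝ} (hx : StrictMono x)
    (hxs : ∀ i, x i ∈ s) (hgx : ∀ i, g (x i) = (-1) ^ (i : ℕ)) {c : ℝ}
    (hc : c ∈ Set.Ioo (-1) 1) : ∃ T : Finset ℝ, T.card = N ∧ ∀ y ∈ T, y ∈ s ∧ g y = c := by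
  have key : ∀ i : Fin N, ∃ y ∈ Set.Ioo (x i.castSucc) (x i.succ), y ∈ s ∧ g y = c := by
    intro i
    have hlt : x i.castSucc < x i.succ := hx i.castSucc_lt_succ
    have hsub : Set.Icc (x i.castSucc) (x i.succ) ⊆ s := hs.out (hxs _) (hxs _)
    have hivt := intermediate_value_uIcc (f := g) (a := x i.castSucc) (b := x i.succ)
      (by rw [Set.uIcc_of_le hlt.le]; exact hg.mono hsub)
    have h1 := hgx i.castSucc
    have h2 := hgx i.succ
    have hmem : c ∈ Set.uIcc (g (x i.castSucc)) (g (x i.succ)) := by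
      rw [h1, h2, Set.mem_uIcc, Fin.val_succ, pow_succ, Fin.val_castSucc]
      rcases neg_one_pow_eq_or ℝ (i : ℕ) with h | h <;> rw [h]
      · exact Or.inr ⟨by linarith [hc.1], by linarith [hc.2]⟩
      · exact Or.inl ⟨by linarith [hc.1], by linarith [hc.2]⟩
    have hne : ∀ j, g (x j) ≠ c := by
      intro j
      rw [hgx]
      rcases neg_one_pow_eq_or ℝ (j : ℕ) with h | h <;> rw [h]
      · exact hc.2.ne'
      · exact hc.1.ne
    obtain ⟨y, hy, hyc⟩ := hivt hmem
    rw [Set.uIcc_of_le hlt.le] at hy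
    refine ⟨y, ⟨lt_of_le_of_ne hy.1 ?_, lt_of_le_of_ne hy.2 ?_⟩, hsub hy, hyc⟩
    · rintro rfl
      exact hne _ hyc
    · rintro rfl
      exact hne _ hyc
  choose y hy hys hyc using key
  have hmono : StrictMono y := fun i j hij =>
    calc y i < x i.succ := (hy i).2
      _ ≤ x j.castSucc := hx.monotone (Fin.succ_le_castSucc_iff.mpr hij)
      _ < y j := (hy j).1
  refine ⟨Finset.univ.map ⟨y, hmono.injective⟩, by simp, fun z hz => ?_⟩
  simp only [Finset.mem_map, Finset.mem_univ, true_and, Function.Embedding.coeFn_mk] at hz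
  obtain ⟨i, rfl⟩ := hz
  exact ⟨hys i, hyc i⟩

/-- `N + 1` linearly independent differentiable functions on an open interval, one of which is
positive, have a linear combination with at least `N` simple zeros. -/
lemma exists_simple_zeros {ι : Type*} [Fintype ι] {s : Set ℝ} (hso : IsOpen s)
    (hs : s.OrdConnected) {f : ι → ℝ → ℝ} (hf : ∀ i, ∀ x ∈ s, DifferentiableAt ℝ (f i) x)
    (hli : ∀ c : ι → ℝ, (∀ x ∈ s, ∑ i, c i * f i x = 0) → c = 0) (i₀ : ι)
    (hpos : ∀ x ∈ s, 0 < f i₀ x) {N : ℕ} (hN : Fintype.card ι = N + 1) :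
    ∃ c : ι → ℝ, ∃ T : Finset ℝ, T.card = N ∧ ∀ x ∈ T, x ∈ s ∧ ∑ i, c i * f i x = 0 ∧
      deriv (fun x => ∑ i, c i * f i x) x ≠ 0 := by
  classical
  obtain ⟨X, hXcard, hXs, hX⟩ := exists_interpolation_points s f hli
  rw [hN] at hXcard
  let x := X.orderEmbOfFin hXcard
  have hxX : ∀ i, x i ∈ X := X.orderEmbOfFin_mem hXcard
  obtain ⟨d, hd⟩ := hX fun z =>
    (if h : ∃ i, x i = z then (-1) ^ (h.choose : ℕ) else 0) * f i₀ z
  let G : ℝ → ℝ := fun z => ∑ i, d i * f i z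
  have hGx : ∀ i, G (x i) = (-1) ^ (i : ℕ) * f i₀ (x i) := by
    intro i
    have h : ∃ j, x j = x i := ⟨i, rfl⟩
    have hi : h.choose = i := x.injective h.choose_spec
    have := hd (x i) (hxX i)
    rwa [dif_pos h, hi] at this
  have hGdiff : ∀ z ∈ s, DifferentiableAt ℝ G z := fun z hz =>
    DifferentiableAt.fun_sum fun i _ => (hf i z hz).const_mul _
  let g : ℝ → ℝ := fun z => G z / f i₀ z
  have hgdiff : ∀ z ∈ s, DifferentiableAt ℝ g z := fun z hz =>
    (hGdiff z hz).fun_div (hf i₀ z hz) (hpos z hz).ne'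
  obtain ⟨c, hc, hreg⟩ := exists_regular_value hgdiff (show (-1 : ℝ) < 1 by norm_num)
  obtain ⟨T, hTcard, hT⟩ := exists_finset_of_alternating hs
    (fun z hz => (hgdiff z hz).continuousAt.continuousWithinAt) x.strictMono
    (fun i => hXs (hxX i)) (fun i => by
      simp only [g, hGx]
      exact mul_div_cancel_right₀ _ (hpos _ (hXs (hxX i))).ne') hc
  have hsum : ∀ z, ∑ i, (d i - c * (if i = i₀ then 1 else 0)) * f i z = G z - c * f i₀ z := by
    intro z
    simp [G, sub_mul, Finset.sum_sub_distrib]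
  refine ⟨fun i => d i - c * (if i = i₀ then 1 else 0), T, hTcard, fun z hz => ?_⟩
  obtain ⟨hzs, hzc⟩ := hT z hz
  have hzero : G z - c * f i₀ z = 0 := by
    rw [← hzc]
    simp only [g]
    rw [div_mul_cancel₀ _ (hpos z hzs).ne', sub_self]
  refine ⟨hzs, (hsum z).trans hzero, ?_⟩
  simp only [hsum]
  have heq : (fun w => G w - c * f i₀ w) =ᶠ[nhds z] fun w => f i₀ w * (g w - c) := by
    filter_upwards [hso.mem_nhds hzs] with w hw
    have := (hpos w hw).ne'
    simp only [g]
    field_simp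
  have hder := (hf i₀ z hzs).hasDerivAt.fun_mul ((hgdiff z hzs).hasDerivAt.sub_const c)
  rw [heq.deriv_eq, hder.deriv, hzc, sub_self, mul_zero, zero_add]
  exact mul_ne_zero (hpos z hzs).ne' (hreg z hzs hzc)

lemma coeff_eq_zero_of_sum_pow_eq_zero {N : ℕ} {a : ℕ → ℝ}
    (h : ∀ x : ℝ, 0 < x → ∑ k ∈ Finset.range N, a k * x ^ k = 0) : ∀ k < N, a k = 0 := by
  let p : Polynomial ℝ := ∑ k ∈ Finset.range N, Polynomial.monomial k (a k)
  have hp : p = 0 := by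
    refine p.eq_zero_of_infinite_isRoot ((Set.Ioi_infinite (0 : ℝ)).mono fun x hx => ?_)
    simpa [p, Polynomial.IsRoot, Polynomial.eval_finsetSum] using h x hx
  intro k hk
  have := congrArg (fun q => Polynomial.coeff q k) hp
  simpa [p, Polynomial.finsetSum_coeff, Polynomial.coeff_monomial, hk] using this

/-- The uniformization `h = 2 cosh t - 2`, under which `√(h(4+h)) = 2 sinh t` and the logarithm
in `F12` becomes `t`. -/
lemma F12_two_mul_cosh_sub_two (n : ℕ) (α β : ℕ → ℝ) (γ0 γ1 γ2 : ℝ) {t : ℝ} (ht : 0 < t) :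
    F12 n α β γ0 γ1 γ2 (2 * cosh t - 2) =
      (∑ k ∈ Finset.range (n - 1), α k * (2 * cosh t - 2) ^ (k + 1))
        + 2 * sinh t * (∑ k ∈ Finset.range (n - 1), β k * (2 * cosh t - 2) ^ k)
        + (γ0 + γ1 * (2 * cosh t - 2) + γ2 * (2 * cosh t - 2) ^ 2) * t := by
  have hsqrt : √((2 * cosh t - 2) * (4 + (2 * cosh t - 2))) = 2 * sinh t := by
    rw [show (2 * cosh t - 2) * (4 + (2 * cosh t - 2)) = (2 * sinh t) ^ 2 by
      linear_combination 4 * cosh_sq t]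
    exact Real.sqrt_sq (by linarith [sinh_pos_iff.mpr ht])
  have hlog : log ((2 + (2 * cosh t - 2) + 2 * sinh t) / 2) = t := by
    rw [show (2 + (2 * cosh t - 2) + 2 * sinh t) / 2 = cosh t + sinh t by ring, cosh_add_sinh,
      log_exp]
  rw [F12, hsqrt, hlog]

lemma F12_linearIndependent (n : ℕ) (α β : ℕ → ℝ) (γ0 γ1 γ2 : ℝ)
    (hF : ∀ h ∈ Set.Ioi (0 : ℝ), F12 n α β γ0 γ1 γ2 h = 0) :
    (∀ k < n - 1, α k = 0) ∧ (∀ k < n - 1, β k = 0) ∧ γ0 = 0 ∧ γ1 = 0 ∧ γ2 = 0 := by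
  let A : ℂ → ℂ := fun t => ∑ k ∈ Finset.range (n - 1), α k * (2 * Complex.cosh t - 2) ^ (k + 1)
  let B : ℂ → ℂ := fun t =>
    2 * Complex.sinh t * ∑ k ∈ Finset.range (n - 1), β k * (2 * Complex.cosh t - 2) ^ k
  let C : ℂ → ℂ := fun t =>
    γ0 + γ1 * (2 * Complex.cosh t - 2) + γ2 * (2 * Complex.cosh t - 2) ^ 2
  have hreal : ∀ t : ℝ, 0 < t → A t + B t + C t * t = 0 := by
    intro t ht
    have h := hF (2 * cosh t - 2) (by
      have := one_lt_cosh.mpr ht.ne'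
      simp only [Set.mem_Ioi]
      linarith)
    rw [F12_two_mul_cosh_sub_two n α β γ0 γ1 γ2 ht] at h
    simpa [A, B, C] using congrArg (fun x : ℝ => (x : ℂ)) h
  have hdiff : Differentiable ℂ fun t => A t + B t + C t * t := by
    simp only [A, B, C]
    fun_prop
  have hall : ∀ t, A t + B t + C t * t = 0 := by
    refine congrFun (AnalyticOnNhd.eq_of_frequently_eq (𝕜 := ℂ) (g := fun _ => 0) (z₀ := 1)
      (fun z _ => hdiff.analyticAt z) (fun z _ => analyticAt_const) ?_)
    have htend : Filter.Tendsto (fun t : ℝ => (t : ℂ)) (nhdsWithin 1 {1}ᶜ)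
        (nhdsWithin 1 {1}ᶜ) := by
      refine tendsto_nhdsWithin_of_tendsto_nhds_of_eventually_within _ ?_ ?_
      · have : Filter.Tendsto (fun t : ℝ => (t : ℂ)) (nhds 1) (nhds ((1 : ℝ) : ℂ)) :=
          Complex.continuous_ofReal.tendsto 1
        rw [Complex.ofReal_one] at this
        exact this.mono_left nhdsWithin_le_nhds
      · filter_upwards [self_mem_nhdsWithin] with t ht
        simpa using ht
    refine htend.frequently (Filter.Eventually.frequently ?_)
    filter_upwards [nhdsWithin_le_nhds (Ioi_mem_nhds (zero_lt_one' ℝ))] with t ht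
    exact hreal t ht
  have hA : ∀ t, A t = 0 := by
    intro t
    have h1 := hall t
    have h2 := hall (-t)
    simp only [A, B, C, Complex.cosh_neg, Complex.sinh_neg] at h1 h2 ⊢
    linear_combination (h1 + h2) / 2
  have hC : ∀ t, C t = 0 := by
    intro t
    have hcosh : Complex.cosh (t + 2 * π * Complex.I) = Complex.cosh t := by
      rw [← Complex.cos_mul_I, ← Complex.cos_mul_I, add_mul, mul_assoc, Complex.I_mul_I, mul_neg_one,
        ← sub_eq_add_neg, Complex.cos_sub_two_pi]
    have hsinh : Complex.sinh (t + 2 * π * Complex.I) = Complex.sinh t := by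
      refine mul_right_cancel₀ Complex.I_ne_zero ?_
      rw [← Complex.sin_mul_I, ← Complex.sin_mul_I, add_mul, mul_assoc, Complex.I_mul_I, mul_neg_one,
        ← sub_eq_add_neg, Complex.sin_sub_two_pi]
    have h1 := hall t
    have h2 := hall (t + 2 * π * Complex.I)
    have h3 : C t * (2 * π * Complex.I) = 0 := by
      simp only [A, B, C, hcosh, hsinh] at h1 h2 ⊢
      linear_combination h2 - h1
    exact (mul_eq_zero.mp h3).resolve_right Complex.two_pi_I_ne_zero
  have hB : ∀ t, B t = 0 := fun t => by linear_combination hall t - hA t - t * hC t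
  have hparam : ∀ h : ℝ, 0 < h → ∃ t : ℝ, 0 < t ∧ 2 * cosh t - 2 = h := fun h hh =>
    ⟨arcosh (1 + h / 2), arcosh_pos (by linarith),
      by rw [cosh_arcosh (by linarith)]; ring⟩
  have hα : ∀ k < n - 1, α k = 0 := by
    refine coeff_eq_zero_of_sum_pow_eq_zero fun h hh => ?_
    obtain ⟨t, -, rfl⟩ := hparam h hh
    have h0 := hA t
    simp only [A, pow_succ, ← mul_assoc, ← Finset.sum_mul] at h0
    refine (mul_eq_zero.mp (?_ : _ * (2 * cosh t - 2) = 0)).resolve_right hh.ne'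
    exact_mod_cast h0
  have hβ : ∀ k < n - 1, β k = 0 := by
    refine coeff_eq_zero_of_sum_pow_eq_zero fun h hh => ?_
    obtain ⟨t, ht, rfl⟩ := hparam h hh
    refine (mul_eq_zero.mp (?_ : 2 * sinh t * _ = 0)).resolve_left
      (mul_ne_zero two_ne_zero (sinh_pos_iff.mpr ht).ne')
    have h0 := hB t
    simp only [B] at h0
    exact_mod_cast h0
  have hγ : ∀ k < 3, (if k = 0 then γ0 else if k = 1 then γ1 else γ2) = 0 := by
    refine coeff_eq_zero_of_sum_pow_eq_zero fun h hh => ?_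
    obtain ⟨t, -, rfl⟩ := hparam h hh
    have h0 := hC t
    simp only [C] at h0
    simpa [Finset.sum_range_succ] using mod_cast h0
  exact ⟨hα, hβ, by simpa using hγ 0, by simpa using hγ 1, by simpa using hγ 2⟩

/-- The functions spanned by `F12`. -/
noncomputable def F12Basis (m : ℕ) : Fin m ⊕ Fin m ⊕ Fin 3 → ℝ → ℝ
  | .inl k => fun h => h ^ (k + 1 : ℕ)
  | .inr (.inl k) => fun h => √(h * (4 + h)) * h ^ (k : ℕ)
  | .inr (.inr k) => fun h => h ^ (k : ℕ) * log ((2 + h + √(h * (4 + h))) / 2)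

lemma differentiableAt_F12Basis {m : ℕ} (i : Fin m ⊕ Fin m ⊕ Fin 3) {h : ℝ} (hh : 0 < h) :
    DifferentiableAt ℝ (F12Basis m i) h := by
  have hsqrt : DifferentiableAt ℝ (fun h : ℝ => √(h * (4 + h))) h :=
    DifferentiableAt.sqrt (by fun_prop) (by positivity)
  have hlog : DifferentiableAt ℝ (fun h : ℝ => log ((2 + h + √(h * (4 + h))) / 2)) h :=
    DifferentiableAt.log (by fun_prop) (by positivity)
  rcases i with k | k | k <;> simp only [F12Basis] <;> fun_prop

lemma exists_F12_eq_sum {n : ℕ} (c : Fin (n - 1) ⊕ Fin (n - 1) ⊕ Fin 3 → ℝ) :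
    ∃ α β : ℕ → ℝ, (∀ k : Fin (n - 1), α k = c (.inl k) ∧ β k = c (.inr (.inl k))) ∧
      F12 n α β (c (.inr (.inr 0))) (c (.inr (.inr 1))) (c (.inr (.inr 2))) =
        fun h => ∑ i, c i * F12Basis (n - 1) i h := by
  refine ⟨fun k => if hk : k < n - 1 then c (.inl ⟨k, hk⟩) else 0,
    fun k => if hk : k < n - 1 then c (.inr (.inl ⟨k, hk⟩)) else 0, by simp, ?_⟩
  funext h
  simp only [F12, Fintype.sum_sum_type, F12Basis, Finset.sum_range, Fin.is_lt, dite_true,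
    Fin.eta, Fin.sum_univ_three, Finset.mul_sum]
  simp only [mul_left_comm, Fin.isValue, Fin.coe_ofNat_eq_mod]
  norm_num
  ring

/-- For every `n ≥ 4` there are coefficients such that `F` has at least
`2n` distinct simple zeros in `(0,∞)`; in particular the `2n+1` functions `h^{k+1}`
(`0 ≤ k ≤ n−2`), `h^k √(h(4+h))` (`0 ≤ k ≤ n−2`) and
`h^k ln((2 + h + √(h(4+h)))/2)` (`k = 0,1,2`) are linearly independent on `(0,∞)`. -/
theorem stmt12 (n : ℕ) (hn : 4 ≤ n) :
    (∃ α β : ℕ → ℝ, ∃ γ0 γ1 γ2 : ℝ, ∃ T : Finset ℝ,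
      2 * n ≤ T.card ∧
      ∀ h ∈ T, h ∈ Set.Ioi (0 : ℝ) ∧ F12 n α β γ0 γ1 γ2 h = 0 ∧
        deriv (F12 n α β γ0 γ1 γ2) h ≠ 0) ∧
    (∀ α β : ℕ → ℝ, ∀ γ0 γ1 γ2 : ℝ,
      (∀ h ∈ Set.Ioi (0 : ℝ), F12 n α β γ0 γ1 γ2 h = 0) →
      (∀ k ≤ n - 2, α k = 0) ∧ (∀ k ≤ n - 2, β k = 0) ∧
        γ0 = 0 ∧ γ1 = 0 ∧ γ2 = 0) := by
  constructor
  · obtain ⟨c, T, hT, h⟩ := exists_simple_zeros isOpen_Ioi Set.ordConnected_Ioi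
      (f := F12Basis (n - 1)) (fun i x hx => differentiableAt_F12Basis i hx) (fun c hc => by
        obtain ⟨α, β, hαβ, hF⟩ := exists_F12_eq_sum c
        obtain ⟨hα, hβ, h0, h1, h2⟩ := F12_linearIndependent n α β _ _ _ fun h hh => by
          rw [hF]
          exact hc h hh
        funext i
        rcases i with k | k | k
        · exact (hαβ k).1.symm.trans (hα k k.2)
        · exact (hαβ k).2.symm.trans (hβ k k.2)
        · fin_cases k <;> assumption)
      (.inl ⟨0, by omega⟩) (fun x hx => pow_pos hx _) (N := 2 * n) (by
        simp only [Fintype.card_sum, Fintype.card_fin]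
        omega)
    obtain ⟨α, β, -, hF⟩ := exists_F12_eq_sum c
    refine ⟨α, β, c (.inr (.inr 0)), c (.inr (.inr 1)), c (.inr (.inr 2)), T, hT.ge, ?_⟩
    rw [hF]
    exact h
  · intro α β γ0 γ1 γ2 hF
    obtain ⟨hα, hβ, hγ⟩ := F12_linearIndependent n α β γ0 γ1 γ2 hF
    exact ⟨fun k hk => hα k (by omega), fun k hk => hβ k (by omega), hγ⟩
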